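/- Let X be a quasi-Banach space which coarsely embeds into a (real, infinite-dimensional) Hilbert space. Then there exist a continuous negative definite function g : X → ℝ, a nondecreasing function φ₁ : [0,∞) → [0,∞) with φ₁(t) → ∞ as t → ∞, and a constant α > 0, such that g(0) = 0 and φ₁(‖x‖) ≤ g(x) ≤ ‖x‖^{2α} for all x ∈ X. -/

import Mathlib

open Filter Function

/-- A quasi-norm on a real vector space `X`: nonnegative, vanishing exactly at `0`,
absolutely homogeneous, and satisfying a `K`-relaxed triangle inequality for some `K ≥ 1`. -/
structure IsQuasiNorm {X : Type*} [AddCommGroup X] [Module ℝ X] (q : X → ℝ) : Prop where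
  nonneg : ∀ x, 0 ≤ q x
  eq_zero_iff : ∀ x, q x = 0 ↔ x = 0
  smul : ∀ (c : ℝ) (x : X), q (c • x) = |c| * q x
  exists_K : ∃ K : ℝ, 1 ≤ K ∧ ∀ x y, q (x + y) ≤ K * (q x + q y)

/-- Completeness of the metrizable linear topology induced by the quasi-norm,
stated sequentially: every Cauchy sequence converges. -/
def QuasiNormComplete {X : Type*} [AddCommGroup X] [Module ℝ X] (q : X → ℝ) : Prop :=
  ∀ u : ℕ → X, (∀ ε > 0, ∃ N, ∀ m ≥ N, ∀ n ≥ N, q (u m - u n) < ε) →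
    ∃ x : X, Tendsto (fun n => q (u n - x)) atTop (nhds 0)

/-- A coarse embedding of a space with distance `d` into a (pseudo)metric space. -/
def IsCoarseEmbedding {X : Type*} {H : Type*} [PseudoMetricSpace H]
    (d : X → X → ℝ) (f : X → H) : Prop :=
  ∃ φ₁ φ₂ : ℝ → ℝ, Monotone φ₁ ∧ Monotone φ₂ ∧ Tendsto φ₁ atTop atTop ∧
    ∀ x y, φ₁ (d x y) ≤ dist (f x) (f y) ∧ dist (f x) (f y) ≤ φ₂ (d x y)

/-- A bundled real, infinite-dimensional Hilbert space. -/
structure InfDimHilbertSpace where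
  carrier : Type
  [grp : NormedAddCommGroup carrier]
  [ips : InnerProductSpace ℝ carrier]
  [cpl : CompleteSpace carrier]
  infdim : ¬ FiniteDimensional ℝ carrier

attribute [instance] InfDimHilbertSpace.grp InfDimHilbertSpace.ips InfDimHilbertSpace.cpl

/-- `X` (with quasi-norm `q`) coarsely embeds into a real infinite-dimensional Hilbert space. -/
def CoarselyEmbedsIntoHilbert (X : Type*) [AddCommGroup X] [Module ℝ X] (q : X → ℝ) : Prop :=
  ∃ (H : InfDimHilbertSpace) (f : X → H.carrier),
    IsCoarseEmbedding (fun x y => q (x - y)) f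

/-- A function `g : X → ℝ` is negative definite: `g(-x) = g(x)` and for all `x₁,…,xₙ ∈ X`
and `c₁,…,cₙ ∈ ℂ` with `∑ᵢ cᵢ = 0`, `∑_{i,j} cᵢ c̄ⱼ g(xᵢ - xⱼ) ≤ 0`. -/
def IsNegativeDefinite {X : Type*} [AddCommGroup X] (g : X → ℝ) : Prop :=
  (∀ x : X, g (-x) = g x) ∧
  ∀ (n : ℕ) (x : Fin n → X) (c : Fin n → ℂ), (∑ i, c i) = 0 →
    (∑ i, ∑ j, c i * (starRingEnd ℂ) (c j) * (g (x i - x j) : ℂ)).re ≤ 0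

open Matrix in
theorem Matrix.PosSemidef.map_exp {ι : Type*} [Fintype ι] {A : Matrix ι ι ℝ}
    (hA : A.PosSemidef) : (A.map Real.exp).PosSemidef := by
  have hpow : ∀ n : ℕ, (A.map fun a => a ^ n).PosSemidef := by
    intro n
    induction n with
    | zero =>
      convert posSemidef_vecMulVec_self_star (fun _ : ι => (1 : ℝ)) using 1
      ext i j
      simp [vecMulVec_apply]
    | succ n ih =>
      have h : (A.map fun a => a ^ (n + 1)) = (A.map fun a => a ^ n) ⊙ A := by
        ext i j
        simp [pow_succ]
      rw [h]
      exact ih.hadamard hA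
  have hpart : ∀ N : ℕ,
      (∑ n ∈ Finset.range N, ((n.factorial : ℝ)⁻¹) • A.map fun a => a ^ n).PosSemidef :=
    fun N => posSemidef_sum _ fun n _ => (hpow n).smul (by positivity)
  have hlim : Tendsto
      (fun N : ℕ => ∑ n ∈ Finset.range N, ((n.factorial : ℝ)⁻¹) • A.map fun a => a ^ n)
      atTop (nhds (A.map Real.exp)) := by
    refine tendsto_pi_nhds.2 fun i => tendsto_pi_nhds.2 fun j => ?_
    have h := (NormedSpace.expSeries_div_hasSum_exp (A i j)).tendsto_sum_nat
    rw [← Real.exp_eq_exp_ℝ] at h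
    refine h.congr fun N => ?_
    simp [Matrix.sum_apply, div_eq_inv_mul]
  refine .of_dotProduct_mulVec_nonneg ?_ fun x => ?_
  · ext i j
    have := hA.isHermitian.apply i j
    simp only [star_trivial] at this
    simp [this]
  · have hc : Continuous fun M : Matrix ι ι ℝ => star x ⬝ᵥ (M *ᵥ x) := by fun_prop
    exact ge_of_tendsto' ((hc.tendsto _).comp hlim) fun N =>
      (hpart N).dotProduct_mulVec_nonneg x

/-- A positive semidefinite real matrix is the Gram matrix of vectors in a Euclidean space. -/
theorem Matrix.PosSemidef.exists_inner_eq {ι : Type*} [Finite ι] {A : Matrix ι ι ℝ}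
    (hA : A.PosSemidef) :
    ∃ (m : ℕ) (v : ι → EuclideanSpace ℝ (Fin m)), ∀ i j, inner ℝ (v i) (v j) = A i j := by
  obtain ⟨m, w, hw⟩ := Matrix.posSemidef_iff_eq_sum_vecMulVec.1 hA
  refine ⟨m, fun i => WithLp.toLp 2 fun k => w k i, fun i j => ?_⟩
  rw [hw]
  simp [PiLp.inner_apply, Matrix.sum_apply, Matrix.vecMulVec_apply, mul_comm]

open Matrix in
/-- The kernel `exp (-t * ‖u - v‖ ^ 2)` is positive semidefinite on a Hilbert space. -/
theorem posSemidef_gaussian {H : Type*} [NormedAddCommGroup H] [InnerProductSpace ℝ H]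
    {ι : Type*} [Fintype ι] (v : ι → H) {t : ℝ} (ht : 0 ≤ t) :
    (Matrix.of fun i j => Real.exp (-(t * ‖v i - v j‖ ^ 2))).PosSemidef := by
  have h1 := ((Matrix.posSemidef_gram ℝ v).smul (show 0 ≤ 2 * t by positivity)).map_exp
  have h2 := Matrix.posSemidef_vecMulVec_self_star fun i => Real.exp (-(t * ‖v i‖ ^ 2))
  have h3 : (Matrix.of fun i j => Real.exp (-(t * ‖v i - v j‖ ^ 2))) =
      ((2 * t) • Matrix.gram ℝ v).map Real.exp ⊙ Matrix.vecMulVec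
        (fun i => Real.exp (-(t * ‖v i‖ ^ 2))) (star fun i => Real.exp (-(t * ‖v i‖ ^ 2))) := by
    ext i j
    simp only [Matrix.of_apply, Matrix.hadamard_apply, Matrix.map_apply, Matrix.smul_apply,
      Matrix.gram_apply, Matrix.vecMulVec_apply, smul_eq_mul, star_trivial,
      ← Real.exp_add, norm_sub_sq_real]
    congr 1
    ring
  rw [h3]
  exact h1.hadamard h2

/-- A finite family in a Hilbert space satisfies `‖y - yᵢ‖² ≤ dᵢ` for some `y` as soon as
`‖yᵢ - yⱼ‖² ≤ dᵢ + dⱼ` (Minty). -/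
theorem exists_norm_sub_sq_le {V : Type*} [NormedAddCommGroup V] [InnerProductSpace ℝ V]
    {ι : Type*} [Fintype ι] (y : ι → V) (d : ι → ℝ)
    (h : ∀ i j, ‖y i - y j‖ ^ 2 ≤ d i + d j) : ∃ z, ∀ i, ‖z - y i‖ ^ 2 ≤ d i := by
  classical
  rcases isEmpty_or_nonempty ι with hι | ⟨⟨i₀⟩⟩
  · exact ⟨0, fun i => isEmptyElim i⟩
  let c : ι → ℝ := fun i => ‖y i‖ ^ 2 - d i
  let Φ : (ι → ℝ) → ℝ := fun w => ∑ i, w i * c i - ‖∑ i, w i • y i‖ ^ 2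
  have hΦ : Continuous Φ := by fun_prop
  obtain ⟨w, hw, hmax⟩ := (isCompact_stdSimplex ℝ ι).exists_isMaxOn
    ⟨_, single_mem_stdSimplex ℝ i₀⟩ hΦ.continuousOn
  obtain ⟨hw0, hw1⟩ := hw
  set z := ∑ i, w i • y i with hz
  have hΦw : Φ w ≤ 0 := by
    have e1 : ∑ i, ∑ j, w i * w j * ‖y i - y j‖ ^ 2 =
        2 * (∑ i, w i * ‖y i‖ ^ 2) - 2 * ‖z‖ ^ 2 := by
      have a1 : ∑ i, ∑ j, w i * w j * inner ℝ (y i) (y j) = ‖z‖ ^ 2 := by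
        rw [← real_inner_self_eq_norm_sq, hz]
        simp only [sum_inner, inner_sum, real_inner_smul_left, real_inner_smul_right, mul_assoc]
        rw [Finset.sum_comm]
        simp only [mul_left_comm]
      have a2 : ∑ i, ∑ j, w i * w j * ‖y i‖ ^ 2 = ∑ i, w i * ‖y i‖ ^ 2 := by
        refine Finset.sum_congr rfl fun i _ => ?_
        rw [← Finset.sum_mul, ← Finset.mul_sum, hw1, mul_one]
      have a3 : ∑ i, ∑ j, w i * w j * ‖y j‖ ^ 2 = ∑ i, w i * ‖y i‖ ^ 2 := by
        rw [Finset.sum_comm, ← a2]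
        simp only [mul_comm]
      calc _ = ∑ i, ∑ j, (w i * w j * ‖y i‖ ^ 2 - 2 * (w i * w j * inner ℝ (y i) (y j))
            + w i * w j * ‖y j‖ ^ 2) := by
            refine Finset.sum_congr rfl fun i _ => Finset.sum_congr rfl fun j _ => ?_
            rw [norm_sub_sq_real]; ring
        _ = _ := by
            simp only [Finset.sum_add_distrib, Finset.sum_sub_distrib, ← Finset.mul_sum]
            rw [a1, a2, a3]; ring
    have e2 : ∑ i, ∑ j, w i * w j * ‖y i - y j‖ ^ 2 ≤ 2 * ∑ i, w i * d i := by
      have a2 : ∑ i, ∑ j, w i * w j * d i = ∑ i, w i * d i := by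
        refine Finset.sum_congr rfl fun i _ => ?_
        rw [← Finset.sum_mul, ← Finset.mul_sum, hw1, mul_one]
      have a3 : ∑ i, ∑ j, w i * w j * d j = ∑ i, w i * d i := by
        rw [Finset.sum_comm, ← a2]
        simp only [mul_comm]
      calc _ ≤ ∑ i, ∑ j, (w i * w j * d i + w i * w j * d j) :=
            Finset.sum_le_sum fun i _ => Finset.sum_le_sum fun j _ => by
              rw [← mul_add]
              exact mul_le_mul_of_nonneg_left (h i j) (mul_nonneg (hw0 i) (hw0 j))
        _ = _ := by
            simp only [Finset.sum_add_distrib]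
            rw [a2, a3]; ring
    have e3 : Φ w = ∑ i, w i * ‖y i‖ ^ 2 - ∑ i, w i * d i - ‖z‖ ^ 2 := by
      simp only [Φ, c, mul_sub, Finset.sum_sub_distrib, hz]
    linarith
  refine ⟨z, fun i => ?_⟩
  have key : ∀ s : ℝ, 0 < s → s ≤ 1 →
      ‖z - y i‖ ^ 2 - d i ≤ Φ w + s * ‖z - y i‖ ^ 2 := by
    intro s hs hs1
    have hmem : (1 - s) • w + s • Pi.single i 1 ∈ stdSimplex ℝ ι :=
      convex_stdSimplex ℝ ι ⟨hw0, hw1⟩ (single_mem_stdSimplex ℝ i) (by linarith) hs.le (by ring)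
    have hle : Φ ((1 - s) • w + s • Pi.single i 1) ≤ Φ w := hmax hmem
    have b1 : ∑ j, ((1 - s) • w + s • Pi.single i (1 : ℝ) : ι → ℝ) j • y j = z + s • (y i - z) := by
      simp only [Pi.add_apply, Pi.smul_apply, smul_eq_mul, add_smul, Finset.sum_add_distrib,
        mul_smul, ← Finset.smul_sum, ← hz]
      simp [Pi.single_apply, ite_smul]
      module
    have b2 : ∑ j, ((1 - s) • w + s • Pi.single i (1 : ℝ) : ι → ℝ) j * c j =
        (1 - s) * ∑ j, w j * c j + s * c i := by
      simp only [Pi.add_apply, Pi.smul_apply, smul_eq_mul, add_mul, Finset.sum_add_distrib,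
        mul_assoc, ← Finset.mul_sum]
      simp [Pi.single_apply]
    have b3 : ‖z + s • (y i - z)‖ ^ 2 =
        ‖z‖ ^ 2 + 2 * s * (inner ℝ z (y i) - ‖z‖ ^ 2) + s ^ 2 * ‖z - y i‖ ^ 2 := by
      rw [norm_add_sq_real, norm_smul, mul_pow, norm_sub_rev (y i), real_inner_smul_right,
        inner_sub_right, real_inner_self_eq_norm_sq, Real.norm_eq_abs, sq_abs]
      ring
    have hle' : (1 - s) * ∑ j, w j * c j + s * c i - ‖z + s • (y i - z)‖ ^ 2 ≤
        ∑ j, w j * c j - ‖z‖ ^ 2 := by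
      have := hle
      simp only [Φ] at this
      rwa [b1, b2] at this
    have b4 : Φ w = ∑ j, w j * c j - ‖z‖ ^ 2 := rfl
    have b5 : ‖z - y i‖ ^ 2 = ‖z‖ ^ 2 - 2 * inner ℝ z (y i) + ‖y i‖ ^ 2 := norm_sub_sq_real _ _
    have b6 : c i = ‖y i‖ ^ 2 - d i := rfl
    rw [b3] at hle'
    refine le_of_mul_le_mul_left ?_ hs
    rw [b4]
    rw [b6] at hle'
    nlinarith
  have hlim : Tendsto (fun s : ℝ => Φ w + s * ‖z - y i‖ ^ 2) (nhdsWithin 0 (Set.Ioi 0))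
      (nhds (Φ w + 0 * ‖z - y i‖ ^ 2)) :=
    ((by fun_prop : Continuous fun s : ℝ => Φ w + s * ‖z - y i‖ ^ 2).tendsto 0).mono_left
      nhdsWithin_le_nhds
  have := ge_of_tendsto hlim (b := ‖z - y i‖ ^ 2 - d i) (by
    filter_upwards [Ioc_mem_nhdsGT (zero_lt_one' ℝ)] with s hs using key s hs.1 hs.2)
  linarith

/-- A finite subset of a Hilbert space embeds into a Euclidean space so that squared distances are
at least logarithmic, and at most a small power, of the original distances. -/
theorem exists_snowflake {H : Type*} [NormedAddCommGroup H] [InnerProductSpace ℝ H]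
    {ι : Type*} [Fintype ι] (v : ι → H) {p : ℝ} (hp0 : 0 < p) (hp2 : p ≤ 2) :
    ∃ (m : ℕ) (b : ι → EuclideanSpace ℝ (Fin m)), ∀ i j,
      (Nat.log 2 ⌊‖v i - v j‖⌋₊ : ℝ) ≤ ‖b i - b j‖ ^ 2 ∧
      ‖b i - b j‖ ^ 2 ≤ 2 * (1 - (2 : ℝ) ^ (-p))⁻¹ * ‖v i - v j‖ ^ p := by
  obtain ⟨J, hJ⟩ : ∃ J : ℕ, ∀ i j, Nat.log 2 ⌊‖v i - v j‖⌋₊ ≤ J :=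
    ⟨Finset.univ.sup fun a : ι × ι => Nat.log 2 ⌊‖v a.1 - v a.2‖⌋₊, fun i j =>
      Finset.le_sup (f := fun a : ι × ι => Nat.log 2 ⌊‖v a.1 - v a.2‖⌋₊) (Finset.mem_univ (i, j))⟩
  have hM := Matrix.posSemidef_sum (Finset.range J) fun l _ =>
    posSemidef_gaussian v (t := ((4 : ℝ) ^ l)⁻¹) (by positivity)
  obtain ⟨m, b, hb⟩ := hM.exists_inner_eq
  have hdist : ∀ i j, ‖b i - b j‖ ^ 2 = ∑ l ∈ Finset.range J,
      2 * (1 - Real.exp (-(((4 : ℝ) ^ l)⁻¹ * ‖v i - v j‖ ^ 2))) := by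
    intro i j
    rw [norm_sub_sq_real, ← real_inner_self_eq_norm_sq, ← real_inner_self_eq_norm_sq, hb, hb, hb]
    simp only [Matrix.sum_apply, Matrix.of_apply, sub_self, norm_zero, mul_sub,
      Finset.sum_sub_distrib, ← Finset.mul_sum]
    simp
    ring
  refine ⟨m, b, fun i j => ?_⟩
  rw [hdist]
  set r := ‖v i - v j‖ with hr
  have hr0 : 0 ≤ r := norm_nonneg _
  have hnonneg : ∀ l : ℕ, 0 ≤ 2 * (1 - Real.exp (-(((4 : ℝ) ^ l)⁻¹ * r ^ 2))) := by
    intro l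
    have : Real.exp (-(((4 : ℝ) ^ l)⁻¹ * r ^ 2)) ≤ 1 :=
      Real.exp_le_one_iff.2 (neg_nonpos.2 (by positivity))
    linarith
  constructor
  · have hterm : ∀ l ∈ Finset.range (Nat.log 2 ⌊r⌋₊),
        (1 : ℝ) ≤ 2 * (1 - Real.exp (-(((4 : ℝ) ^ l)⁻¹ * r ^ 2))) := by
      intro l hl
      have hl := Finset.mem_range.1 hl
      have hfl : ⌊r⌋₊ ≠ 0 := fun h => by simp [h] at hl
      have h2 : (2 : ℝ) ^ l ≤ r := by
        have := Nat.pow_le_of_le_log hfl hl.le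
        calc (2 : ℝ) ^ l = ((2 ^ l : ℕ) : ℝ) := by push_cast; rfl
          _ ≤ ⌊r⌋₊ := by exact_mod_cast this
          _ ≤ r := Nat.floor_le hr0
      have h4 : (1 : ℝ) ≤ ((4 : ℝ) ^ l)⁻¹ * r ^ 2 := by
        rw [inv_mul_eq_div, one_le_div (by positivity)]
        calc (4 : ℝ) ^ l = (2 ^ l) ^ 2 := by rw [← pow_mul, mul_comm, pow_mul]; norm_num
          _ ≤ r ^ 2 := by gcongr
      have h5 : Real.exp (-(((4 : ℝ) ^ l)⁻¹ * r ^ 2)) ≤ Real.exp (-1) :=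
        Real.exp_le_exp.2 (by linarith)
      have := Real.exp_neg_one_lt_half
      linarith
    calc ((Nat.log 2 ⌊r⌋₊ : ℕ) : ℝ) = ∑ l ∈ Finset.range (Nat.log 2 ⌊r⌋₊), (1 : ℝ) := by simp
      _ ≤ ∑ l ∈ Finset.range (Nat.log 2 ⌊r⌋₊), _ := Finset.sum_le_sum hterm
      _ ≤ _ := Finset.sum_le_sum_of_subset_of_nonneg (Finset.range_mono (hJ i j))
          fun l _ _ => hnonneg l
  · have hterm : ∀ l ∈ Finset.range J, 2 * (1 - Real.exp (-(((4 : ℝ) ^ l)⁻¹ * r ^ 2))) ≤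
        2 * r ^ p * ((2 : ℝ) ^ (-p)) ^ l := by
      intro l _
      set t := ((4 : ℝ) ^ l)⁻¹ * r ^ 2 with ht
      have ht0 : 0 ≤ t := by positivity
      have h1 : t ^ (p / 2) = r ^ p * ((2 : ℝ) ^ (-p)) ^ l := by
        have : t = (r * ((2 : ℝ) ^ l)⁻¹) ^ (2 : ℝ) := by
          rw [Real.rpow_two, mul_pow, ht, inv_pow, ← pow_mul, mul_comm l, pow_mul]
          norm_num
          ring
        rw [this, ← Real.rpow_mul (by positivity), mul_div_cancel₀ _ two_ne_zero,
          Real.mul_rpow hr0 (by positivity), Real.inv_rpow (by positivity),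
          ← Real.rpow_natCast, ← Real.rpow_mul (by norm_num), Real.rpow_neg (by norm_num),
          inv_pow, ← Real.rpow_natCast, ← Real.rpow_mul (by norm_num), mul_comm p]
      have h2 : 1 - Real.exp (-t) ≤ t ^ (p / 2) := by
        rcases le_total t 1 with h | h
        · have e1 := Real.add_one_le_exp (-t)
          have e2 := Real.rpow_le_rpow_of_exponent_ge_of_imp ht0 h (show p / 2 ≤ 1 by linarith)
            (fun _ => by simp)
          rw [Real.rpow_one] at e2
          linarith
        · have e1 := Real.exp_pos (-t)
          have e2 := Real.one_le_rpow h (show 0 ≤ p / 2 by linarith)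
          linarith
      rw [mul_assoc, ← h1]
      linarith
    have hx0 : (0 : ℝ) ≤ 2 ^ (-p) := by positivity
    have hx1 : (2 : ℝ) ^ (-p) < 1 := Real.rpow_lt_one_of_one_lt_of_neg (by norm_num) (by linarith)
    calc _ ≤ ∑ l ∈ Finset.range J, 2 * r ^ p * ((2 : ℝ) ^ (-p)) ^ l := Finset.sum_le_sum hterm
      _ = 2 * r ^ p * ∑ l ∈ Finset.range J, ((2 : ℝ) ^ (-p)) ^ l := by rw [Finset.mul_sum]
      _ ≤ 2 * r ^ p * (1 - (2 : ℝ) ^ (-p))⁻¹ := by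
        gcongr
        rw [← tsum_geometric_of_lt_one hx0 hx1]
        exact (summable_geometric_of_lt_one hx0 hx1).sum_le_tsum _ fun _ _ => by positivity
      _ = _ := by ring

/-- A map on a finite space which is square-root Lipschitz at large distances is close to
a square-root Lipschitz map. -/
theorem exists_close_holder {X V : Type*} [PseudoMetricSpace X] [Fintype X]
    [NormedAddCommGroup V] [InnerProductSpace ℝ V] (b : X → V) {C : ℝ} (hC : 0 ≤ C)
    (hb : ∀ x y, ‖b x - b y‖ ^ 2 ≤ C * (dist x y + 1)) :
    ∃ h : X → V, (∀ x y, ‖h x - h y‖ ^ 2 ≤ C * dist x y) ∧ ∀ x, ‖h x - b x‖ ^ 2 ≤ C / 2 := by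
  classical
  suffices H : ∀ G : Finset X, ∃ h : X → V,
      (∀ x ∈ G, ∀ y ∈ G, ‖h x - h y‖ ^ 2 ≤ C * dist x y) ∧
      ∀ x ∈ G, ∀ z, ‖h x - b z‖ ^ 2 ≤ C * (dist x z + 1 / 2) by
    obtain ⟨h, h1, h2⟩ := H Finset.univ
    refine ⟨h, fun x y => h1 x (Finset.mem_univ _) y (Finset.mem_univ _), fun x => ?_⟩
    have := h2 x (Finset.mem_univ _) x
    rw [dist_self] at this
    linarith
  intro G
  induction G using Finset.induction_on with
  | empty => exact ⟨0, by simp, by simp⟩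
  | insert a G ha ih =>
    obtain ⟨h, h1, h2⟩ := ih
    obtain ⟨z, hz⟩ := exists_norm_sub_sq_le (Sum.elim b fun g : G => h g)
      (Sum.elim (fun x => C * (dist a x + 1 / 2)) fun g : G => C * dist a g) (by
        rintro (x | x) (y | y) <;> simp only [Sum.elim_inl, Sum.elim_inr, ← mul_add]
        · refine (hb x y).trans (mul_le_mul_of_nonneg_left ?_ hC)
          have := dist_triangle_left x y a
          linarith
        · rw [norm_sub_rev]
          refine (h2 y y.2 x).trans (mul_le_mul_of_nonneg_left ?_ hC)
          have := dist_triangle_left (y : X) x a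
          linarith
        · refine (h2 x x.2 y).trans (mul_le_mul_of_nonneg_left ?_ hC)
          have := dist_triangle_left (x : X) y a
          linarith
        · exact (h1 x x.2 y y.2).trans
            (mul_le_mul_of_nonneg_left (dist_triangle_left (x : X) y a) hC))
    have hne : ∀ x ∈ G, x ≠ a := fun x hx hxa => ha (hxa ▸ hx)
    refine ⟨Function.update h a z, ?_, ?_⟩
    · intro x hx' y hy'
      rcases Finset.mem_insert.1 hx' with rfl | hx <;> rcases Finset.mem_insert.1 hy' with rfl | hy
      · simp
      · rw [Function.update_self, Function.update_of_ne (hne y hy)]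
        exact hz (Sum.inr ⟨y, hy⟩)
      · rw [Function.update_self, Function.update_of_ne (hne x hx), norm_sub_rev, dist_comm]
        exact hz (Sum.inr ⟨x, hx⟩)
      · rw [Function.update_of_ne (hne x hx), Function.update_of_ne (hne y hy)]
        exact h1 x hx y hy
    · intro x hx w
      rcases Finset.mem_insert.1 hx with rfl | hx
      · rw [Function.update_self]
        exact hz (Sum.inl w)
      · rw [Function.update_of_ne (hne x hx)]
        exact h2 x hx w

/-- The **Markov–Kakutani** fixed point theorem for commuting continuous linear maps. -/
theorem exists_common_fixedPoint {E : Type*} [AddCommGroup E] [Module ℝ E] [TopologicalSpace E]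
    [IsTopologicalAddGroup E] [ContinuousSMul ℝ E] [T2Space E] {ι : Type*} (T : ι → E →L[ℝ] E)
    (hcomm : ∀ i j x, T i (T j x) = T j (T i x)) {S : Set E} (hS : IsCompact S)
    (hconv : Convex ℝ S) (hne : S.Nonempty) (hmaps : ∀ i, Set.MapsTo (T i) S S) :
    ∃ x ∈ S, ∀ i, T i x = x := by
  classical
  have single : ∀ (A : E →L[ℝ] E) (R : Set E), IsCompact R → Convex ℝ R → R.Nonempty →
      Set.MapsTo A R R → ∃ x ∈ R, A x = x := by
    rintro A R hR hRc ⟨x, hx⟩ hA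
    have hiter : ∀ k : ℕ, A^[k] x ∈ R := fun k => hA.iterate k hx
    let u : ℕ → E := fun n => ((n : ℝ) + 1)⁻¹ • ∑ k ∈ Finset.range (n + 1), A^[k] x
    have hu : ∀ n, u n ∈ R := by
      intro n
      have : (0 : ℝ) < n + 1 := by positivity
      simp only [u, Finset.smul_sum]
      refine hRc.sum_mem (fun _ _ => by positivity) ?_ fun k _ => hiter k
      simp
      field_simp
    have hdiff : ∀ n, A (u n) - u n = ((n : ℝ) + 1)⁻¹ • (A^[n + 1] x - x) := by
      intro n
      simp only [u, map_smul, map_sum, ← smul_sub, ← Finset.sum_sub_distrib]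
      congr 1
      have := Finset.sum_range_sub (fun k => A^[k] x) (n + 1)
      simpa only [Function.iterate_succ_apply', Function.iterate_zero, id_eq] using this
    have hlim0 : Tendsto (fun n => A (u n) - u n) atTop (nhds 0) := by
      simp only [hdiff]
      exact ((hR.isVonNBounded ℝ).sub (hR.isVonNBounded ℝ)).smul_tendsto_zero
        (Eventually.of_forall fun n => Set.sub_mem_sub (hiter (n + 1)) hx)
        (by simpa using tendsto_one_div_add_atTop_nhds_zero_nat (𝕜 := ℝ))
    obtain ⟨z, hz, hlim⟩ := isCompact_iff_ultrafilter_le_nhds'.1 hR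
      ((hyperfilter ℕ).map u)
      (Ultrafilter.mem_map.2 (Eventually.of_forall hu))
    have hlim : Tendsto u (hyperfilter ℕ) (nhds z) := hlim
    refine ⟨z, hz, sub_eq_zero.1 (tendsto_nhds_unique
      (((A.continuous.tendsto z).comp hlim).sub hlim)
      (hlim0.mono_left Nat.hyperfilter_le_atTop))⟩
  have hclosed : ∀ i, IsClosed {x | T i x = x} := fun i =>
    isClosed_eq (T i).continuous continuous_id
  have hfin : ∀ F : Finset ι, (S ∩ ⋂ i ∈ F, {x | T i x = x}).Nonempty := by
    intro F
    induction F using Finset.induction_on with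
    | empty => simpa using hne
    | insert a F _ ih =>
      obtain ⟨x, ⟨hx, hxF⟩, hxa⟩ := single (T a) _
        (hS.inter_right (isClosed_biInter fun i _ => hclosed i))
        (hconv.inter (convex_iInter₂ fun i _ => by
          intro x hx y hy s t _ _ _
          simp only [Set.mem_ofPred_eq] at hx hy ⊢
          rw [map_add, map_smul, map_smul, hx, hy])) ih (by
          rintro x ⟨hx, hxF⟩
          refine ⟨hmaps a hx, ?_⟩
          simp only [Set.mem_iInter, Set.mem_ofPred_eq] at hxF ⊢
          intro i hi
          rw [hcomm, hxF i hi])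
      refine ⟨x, hx, ?_⟩
      simp only [Set.mem_iInter, Set.mem_ofPred_eq, Finset.mem_insert, forall_eq_or_imp] at hxF ⊢
      exact ⟨hxa, hxF⟩
  obtain ⟨x, hx, hxi⟩ := hS.inter_iInter_nonempty _ hclosed hfin
  exact ⟨x, hx, by simpa using hxi⟩

/-- The kernel `k` has on the points of `s` the properties of a squared Hilbert space distance
bounded below by `L` and above by `U`. -/
structure IsHilbertKernelOn {X : Type*} (L U : X → X → ℝ) (s : Set X) (k : X → X → ℝ) :
    Prop where
  symm : ∀ x ∈ s, ∀ y ∈ s, k x y = k y x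
  diag : ∀ x ∈ s, k x x = 0
  lower : ∀ x ∈ s, ∀ y ∈ s, L x y ≤ k x y
  upper : ∀ x ∈ s, ∀ y ∈ s, k x y ≤ U x y
  sub_le : ∀ x ∈ s, ∀ y ∈ s, ∀ z ∈ s, k x z - k y z ≤ √(U x y) * (√(U x z) + √(U y z))
  negDef : ∀ (n : ℕ) (x : Fin n → X) (c : Fin n → ℝ), (∀ i, x i ∈ s) → ∑ i, c i = 0 →
    ∑ i, ∑ j, c i * c j * k (x i) (x j) ≤ 0

theorem isHilbertKernelOn_norm_sub_sq {X V : Type*} [NormedAddCommGroup V]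
    [InnerProductSpace ℝ V] {L U : X → X → ℝ} {s : Set X} (h : X → V)
    (hL : ∀ x ∈ s, ∀ y ∈ s, L x y ≤ ‖h x - h y‖ ^ 2)
    (hU : ∀ x ∈ s, ∀ y ∈ s, ‖h x - h y‖ ^ 2 ≤ U x y) :
    IsHilbertKernelOn L U s fun x y => ‖h x - h y‖ ^ 2 where
  symm x _ y _ := by rw [norm_sub_rev]
  diag x _ := by simp
  lower := hL
  upper := hU
  sub_le x hx y hy z hz := by
    have h1 := Real.le_sqrt_of_sq_le (hU x hx y hy)
    have h2 := Real.le_sqrt_of_sq_le (hU x hx z hz)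
    have h3 := Real.le_sqrt_of_sq_le (hU y hy z hz)
    have h4 := norm_sub_le_norm_sub_add_norm_sub (h x) (h y) (h z)
    calc ‖h x - h z‖ ^ 2 - ‖h y - h z‖ ^ 2
        = (‖h x - h z‖ - ‖h y - h z‖) * (‖h x - h z‖ + ‖h y - h z‖) := by ring
      _ ≤ ‖h x - h y‖ * (‖h x - h z‖ + ‖h y - h z‖) := by
        gcongr
        linarith
      _ ≤ _ := by gcongr
  negDef n x c _ hc := by
    have e := inner_sum_smul_sum_smul_of_sum_eq_zero (fun i => h (x i)) hc (fun i => h (x i)) hc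
    rw [real_inner_self_eq_norm_sq] at e
    have := sq_nonneg ‖∑ i, c i • h (x i)‖
    simp only [sq] at this e ⊢
    linarith

theorem IsHilbertKernelOn.of_tendsto {X ι : Type*} {L U : X → X → ℝ} {s : ι → Set X}
    {k : ι → X → X → ℝ} {k₀ : X → X → ℝ} {l : Filter ι} [l.NeBot]
    (hk : ∀ i, IsHilbertKernelOn L U (s i) (k i)) (hs : ∀ x, ∀ᶠ i in l, x ∈ s i)
    (hlim : ∀ x y, Tendsto (fun i => k i x y) l (nhds (k₀ x y))) :
    IsHilbertKernelOn L U Set.univ k₀ where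
  symm x _ y _ := tendsto_nhds_unique ((hlim x y).congr' (by
    filter_upwards [hs x, hs y] with i hx hy using (hk i).symm x hx y hy)) (hlim y x)
  diag x _ := tendsto_nhds_unique ((hlim x x).congr' (by
    filter_upwards [hs x] with i hx using (hk i).diag x hx)) tendsto_const_nhds
  lower x _ y _ := ge_of_tendsto (hlim x y) (by
    filter_upwards [hs x, hs y] with i hx hy using (hk i).lower x hx y hy)
  upper x _ y _ := le_of_tendsto (hlim x y) (by
    filter_upwards [hs x, hs y] with i hx hy using (hk i).upper x hx y hy)
  sub_le x _ y _ z _ := le_of_tendsto ((hlim x z).sub (hlim y z)) (by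
    filter_upwards [hs x, hs y, hs z] with i hx hy hz using (hk i).sub_le x hx y hy z hz)
  negDef n x c _ hc := le_of_tendsto
    (tendsto_finsetSum _ fun i _ => tendsto_finsetSum _ fun j _ => (hlim (x i) (x j)).const_mul _)
    (by filter_upwards [eventually_all.2 fun i => hs (x i)] with i hi
        using (hk i).negDef n x c hi hc)

theorem convex_isHilbertKernelOn {X : Type*} (L U : X → X → ℝ) (s : Set X) :
    Convex ℝ {k | IsHilbertKernelOn L U s k} := by
  intro k hk k' hk' a b ha hb hab
  simp only [Set.mem_ofPred_eq] at hk hk' ⊢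
  have comb : ∀ {u v w : ℝ}, u ≤ w → v ≤ w → a * u + b * v ≤ w := fun {u v w} hu hv => by
    have h1 := mul_le_mul_of_nonneg_left hu ha
    have h2 := mul_le_mul_of_nonneg_left hv hb
    have h3 : a * w + b * w = w := by rw [← add_mul, hab, one_mul]
    linarith
  constructor <;> simp only [Pi.add_apply, Pi.smul_apply, smul_eq_mul]
  · intro x hx y hy
    rw [hk.symm x hx y hy, hk'.symm x hx y hy]
  · intro x hx
    rw [hk.diag x hx, hk'.diag x hx]
    simp
  · intro x hx y hy
    have := comb (neg_le_neg (hk.lower x hx y hy)) (neg_le_neg (hk'.lower x hx y hy))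
    linarith
  · intro x hx y hy
    exact comb (hk.upper x hx y hy) (hk'.upper x hx y hy)
  · intro x hx y hy z hz
    have := comb (hk.sub_le x hx y hy z hz) (hk'.sub_le x hx y hy z hz)
    linarith
  · intro n x c hx hc
    have := comb (hk.negDef n x c hx hc) (hk'.negDef n x c hx hc)
    simp only [Finset.mul_sum, ← Finset.sum_add_distrib] at this
    refine (Finset.sum_congr rfl fun i _ => Finset.sum_congr rfl fun j _ => ?_).trans_le this
    ring

theorem isCompact_isHilbertKernelOn_univ {X : Type*} (L U : X → X → ℝ) :
    IsCompact {k | IsHilbertKernelOn L U Set.univ k} := by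
  have hK : IsCompact (Set.univ.pi fun x => Set.univ.pi fun y => Set.Icc (L x y) (U x y)) :=
    isCompact_univ_pi fun x => isCompact_univ_pi fun y => isCompact_Icc
  refine hK.of_isClosed_subset ?_ fun k (hk : IsHilbertKernelOn L U Set.univ k) x _ y _ =>
    ⟨hk.lower x trivial y trivial, hk.upper x trivial y trivial⟩
  refine isClosed_iff_ultrafilter.2 fun k l hl hmem => ?_
  have hpos : ∀ᶠ k' in (l : Filter (X → X → ℝ)), IsHilbertKernelOn L U Set.univ k' := hmem
  obtain ⟨k₁, hk₁⟩ := hpos.exists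
  classical
  refine IsHilbertKernelOn.of_tendsto (l := (l : Filter (X → X → ℝ)))
    (s := fun _ => Set.univ)
    (k := fun k' => if IsHilbertKernelOn L U Set.univ k' then k' else k₁) ?_ (by simp) ?_
  · intro k'
    split_ifs with h
    exacts [h, hk₁]
  · intro x y
    have hc : Continuous fun k' : X → X → ℝ => k' x y := by fun_prop
    refine ((hc.tendsto k).mono_left hl).congr' ?_
    filter_upwards [hpos] with k' hk'
    rw [if_pos hk']

theorem exists_isHilbertKernelOn_univ {X : Type*} {L U : X → X → ℝ}
    (h : ∀ F : Finset X, ∃ k, IsHilbertKernelOn L U (F : Set X) k) :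
    ∃ k, IsHilbertKernelOn L U Set.univ k := by
  classical
  choose k hk using h
  let l : Ultrafilter (Finset X) := Ultrafilter.of atTop
  have hmem : ∀ x, ∀ᶠ F : Finset X in (l : Filter (Finset X)), x ∈ (F : Set X) := fun x =>
    Ultrafilter.of_le atTop ((eventually_ge_atTop {x}).mono fun F hF => by simpa using hF)
  have hlim : ∀ x y, ∃ a, Tendsto (fun F => k F x y) l (nhds a) := by
    intro x y
    obtain ⟨a, -, ha⟩ := isCompact_iff_ultrafilter_le_nhds'.1
      (isCompact_Icc (a := L x y) (b := U x y)) (l.map fun F => k F x y) (by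
        change ∀ᶠ F in (l : Filter (Finset X)), k F x y ∈ Set.Icc (L x y) (U x y)
        filter_upwards [hmem x, hmem y] with F hx hy
          using ⟨(hk F).lower x hx y hy, (hk F).upper x hx y hy⟩)
    exact ⟨a, ha⟩
  choose k₀ hk₀ using hlim
  exact ⟨k₀, .of_tendsto hk hmem hk₀⟩

/-- Averaging: translation invariant bounds on kernels on an abelian group are attained by
translation invariant kernels. -/
theorem exists_invariant_isHilbertKernelOn {X : Type*} [AddCommGroup X] {L U : X → X → ℝ}
    (hL : ∀ z x y, L (x + z) (y + z) = L x y) (hU : ∀ z x y, U (x + z) (y + z) = U x y)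
    (h : ∃ k, IsHilbertKernelOn L U Set.univ k) :
    ∃ k, IsHilbertKernelOn L U Set.univ k ∧ ∀ z x y, k (x + z) (y + z) = k x y := by
  let T : X → (X → X → ℝ) →L[ℝ] (X → X → ℝ) := fun z =>
    { toFun := fun k x y => k (x + z) (y + z)
      map_add' := fun _ _ => rfl
      map_smul' := fun _ _ => rfl
      cont := by fun_prop }
  obtain ⟨k, hk, hfix⟩ := exists_common_fixedPoint T
    (fun z w k => by
      funext x y
      change k (x + z + w) (y + z + w) = k (x + w + z) (y + w + z)
      rw [add_right_comm, add_right_comm y])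
    (isCompact_isHilbertKernelOn_univ L U) (convex_isHilbertKernelOn L U Set.univ) h (by
      intro z k hk
      have hk : IsHilbertKernelOn L U Set.univ k := hk
      refine (?_ : IsHilbertKernelOn L U Set.univ fun x y => k (x + z) (y + z))
      refine ⟨fun x _ y _ => hk.symm _ trivial _ trivial, fun x _ => hk.diag _ trivial,
        fun x _ y _ => ?_, fun x _ y _ => ?_, fun x _ y _ w _ => ?_, fun n x c _ hc =>
        hk.negDef n (fun i => x i + z) c (fun _ => trivial) hc⟩
      · rw [← hL z]
        exact hk.lower _ trivial _ trivial
      · rw [← hU z]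
        exact hk.upper _ trivial _ trivial
      · rw [← hU z x y, ← hU z x w, ← hU z y w]
        exact hk.sub_le _ trivial _ trivial _ trivial)
  exact ⟨k, hk, fun z x y => congrFun (congrFun (hfix z) x) y⟩

/-- A suitable power of a quasi-norm is equivalent to a pseudometric (Aoki–Rolewicz). -/
theorem IsQuasiNorm.exists_pseudoMetricSpace {X : Type*} [AddCommGroup X] [Module ℝ X]
    {q : X → ℝ} (hq : IsQuasiNorm q) :
    ∃ p : ℝ, 0 < p ∧ p ≤ 1 ∧ ∃ m : PseudoMetricSpace X,
      ∀ x y, m.dist x y ≤ q (x - y) ^ p ∧ q (x - y) ^ p ≤ 2 * m.dist x y := by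
  obtain ⟨K, hK1, hK⟩ := hq.exists_K
  have hK0 : 0 ≤ K := zero_le_one.trans hK1
  have h3 : (1 : ℝ) < 3 * K ^ 2 := by nlinarith
  have hlog : 0 < Real.log (3 * K ^ 2) := Real.log_pos h3
  have hlog2 : 0 < Real.log 2 := Real.log_pos one_lt_two
  let p : ℝ := min 1 (Real.log 2 / Real.log (3 * K ^ 2))
  have hp : 0 < p := lt_min one_pos (div_pos hlog2 hlog)
  have hp2 : (3 * K ^ 2) ^ p ≤ 2 := by
    rw [Real.rpow_def_of_pos (by linarith), ← Real.le_log_iff_exp_le two_pos, mul_comm,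
      ← le_div_iff₀ hlog]
    exact min_le_right _ _
  have hneg : ∀ x, q (-x) = q x := fun x => by simpa using hq.smul (-1) x
  have hpow : ∀ x y, 0 ≤ q (x - y) ^ p := fun x y => Real.rpow_nonneg (hq.nonneg _) _
  let d : X → X → NNReal := fun x y => ⟨q (x - y) ^ p, hpow x y⟩
  have hself : ∀ x, d x x = 0 := fun x => by
    refine NNReal.eq ?_
    change q (x - x) ^ p = 0
    rw [sub_self, (hq.eq_zero_iff 0).2 rfl, Real.zero_rpow hp.ne']
  have hcomm : ∀ x y, d x y = d y x := fun x y => by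
    refine NNReal.eq ?_
    change q (x - y) ^ p = q (y - x) ^ p
    rw [← neg_sub, hneg]
  have htri : ∀ x₁ x₂ x₃ x₄, d x₁ x₄ ≤ 2 * max (d x₁ x₂) (max (d x₂ x₃) (d x₃ x₄)) := by
    intro x₁ x₂ x₃ x₄
    have hmono : Monotone fun t : NNReal => t ^ p := fun a b hab =>
      NNReal.rpow_le_rpow hab hp.le
    let e : X → X → NNReal := fun x y => ⟨q (x - y), hq.nonneg _⟩
    have hde : ∀ x y, d x y = e x y ^ p := fun x y => rfl
    rw [hde, hde, hde, hde, ← hmono.map_max, ← hmono.map_max]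
    set M := max (e x₁ x₂) (max (e x₂ x₃) (e x₃ x₄)) with hM
    have m1 : q (x₁ - x₂) ≤ M := NNReal.coe_le_coe.2 (le_max_left (e x₁ x₂) _)
    have m2 : q (x₂ - x₃) ≤ M :=
      NNReal.coe_le_coe.2 ((le_max_left (e x₂ x₃) _).trans (le_max_right _ _))
    have m3 : q (x₃ - x₄) ≤ M :=
      NNReal.coe_le_coe.2 ((le_max_right _ (e x₃ x₄)).trans (le_max_right _ _))
    have hM0 : (0 : ℝ) ≤ M := M.2
    have hle : q (x₁ - x₄) ≤ 3 * K ^ 2 * M := by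
      have a1 := hK (x₁ - x₂) (x₂ - x₄)
      have a2 := hK (x₂ - x₃) (x₃ - x₄)
      rw [sub_add_sub_cancel] at a1 a2
      calc q (x₁ - x₄) ≤ K * (M + K * (M + M)) :=
            a1.trans (mul_le_mul_of_nonneg_left (add_le_add m1
              (a2.trans (mul_le_mul_of_nonneg_left (add_le_add m2 m3) hK0))) hK0)
        _ ≤ 3 * K ^ 2 * M := by nlinarith [mul_nonneg hK0 hM0]
    refine NNReal.coe_le_coe.1 ?_
    change q (x₁ - x₄) ^ p ≤ 2 * (M : ℝ) ^ p
    calc q (x₁ - x₄) ^ p ≤ (3 * K ^ 2 * M) ^ p := Real.rpow_le_rpow (hq.nonneg _) hle hp.le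
      _ = (3 * K ^ 2) ^ p * (M : ℝ) ^ p := Real.mul_rpow (by positivity) hM0
      _ ≤ 2 * (M : ℝ) ^ p := by gcongr
  exact ⟨p, hp, min_le_left _ _, PseudoMetricSpace.ofPreNNDist d hself hcomm, fun x y =>
    ⟨PseudoMetricSpace.dist_ofPreNNDist_le d hself hcomm x y,
      PseudoMetricSpace.le_two_mul_dist_ofPreNNDist d hself hcomm htri x y⟩⟩

/-- A map which is bounded on unit distances is Lipschitz at large distances. -/
theorem IsQuasiNorm.dist_le_of_dist_le {X : Type*} [AddCommGroup X] [Module ℝ X] {q : X → ℝ}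
    (hq : IsQuasiNorm q) {H : Type*} [PseudoMetricSpace H] (f : X → H) {C : ℝ} (hC : 0 ≤ C)
    (hf : ∀ x y, q (x - y) ≤ 1 → dist (f x) (f y) ≤ C) (x y : X) :
    dist (f x) (f y) ≤ C * (q (x - y) + 1) := by
  set n := max ⌈q (x - y)⌉₊ 1 with hn
  have hn0 : (0 : ℝ) < n := by
    exact_mod_cast (zero_lt_one.trans_le (le_max_right _ _) : 0 < n)
  have hqn : q (x - y) ≤ n :=
    (Nat.le_ceil _).trans (by exact_mod_cast le_max_left _ _)
  let u : ℕ → X := fun i => y + ((i : ℝ) / n) • (x - y)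
  have hu0 : u 0 = y := by simp [u]
  have hun : u n = x := by simp [u, div_self hn0.ne']
  have hstep : ∀ i : ℕ, dist (f (u i)) (f (u (i + 1))) ≤ C := by
    intro i
    refine hf _ _ ?_
    have : u i - u (i + 1) = (-(n : ℝ)⁻¹) • (x - y) := by
      simp only [u, add_sub_add_left_eq_sub, ← sub_smul]
      congr 1
      push_cast
      field_simp
      ring
    rw [this, hq.smul, abs_neg, abs_of_nonneg (by positivity), inv_mul_le_one₀ hn0]
    exact hqn
  have hn1 : (n : ℝ) ≤ q (x - y) + 1 := by
    rw [hn, Nat.cast_max, Nat.cast_one]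
    exact max_le (Nat.ceil_lt_add_one (hq.nonneg _)).le (by linarith [hq.nonneg (x - y)])
  have hsum := dist_le_range_sum_dist (fun i => f (u i)) n
  rw [hu0, hun, dist_comm] at hsum
  calc dist (f x) (f y) ≤ ∑ i ∈ Finset.range n, dist (f (u i)) (f (u (i + 1))) := hsum
    _ ≤ ∑ i ∈ Finset.range n, C := Finset.sum_le_sum fun i _ => hstep i
    _ = C * n := by simp [mul_comm]
    _ ≤ C * (q (x - y) + 1) := by gcongr

theorem IsHilbertKernelOn.isNegativeDefinite {X : Type*} [AddCommGroup X] {L U k : X → X → ℝ}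
    (hk : IsHilbertKernelOn L U Set.univ k) (hinv : ∀ z x y, k (x + z) (y + z) = k x y)
    {a : ℝ} (ha : 0 ≤ a) : IsNegativeDefinite fun x => a * k x 0 := by
  have hsub : ∀ x y, k (x - y) 0 = k x y := fun x y => by
    rw [← hinv y, sub_add_cancel, zero_add]
  constructor
  · intro x
    have h := hinv x (-x) 0
    rw [neg_add_cancel, zero_add] at h
    change a * k (-x) 0 = a * k x 0
    rw [← h, hk.symm _ trivial _ trivial]
  · intro n x c hc
    have hre := hk.negDef n x (fun i => (c i).re) (fun _ => trivial)
      (by simpa using congrArg Complex.re hc)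
    have him := hk.negDef n x (fun i => (c i).im) (fun _ => trivial)
      (by simpa using congrArg Complex.im hc)
    have heq : (∑ i, ∑ j, c i * (starRingEnd ℂ) (c j) * ((a * k (x i - x j) 0 : ℝ) : ℂ)).re =
        a * (∑ i, ∑ j, (c i).re * (c j).re * k (x i) (x j) +
          ∑ i, ∑ j, (c i).im * (c j).im * k (x i) (x j)) := by
      simp only [Complex.re_sum, Complex.mul_re, Complex.conj_re, Complex.conj_im,
        Complex.ofReal_re, Complex.ofReal_im, hsub, ← Finset.sum_add_distrib, Finset.mul_sum]
      refine Finset.sum_congr rfl fun i _ => Finset.sum_congr rfl fun j _ => ?_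
      ring
    rw [heq]
    exact mul_nonpos_of_nonneg_of_nonpos ha (add_nonpos hre him)

/-- A coarse embedding into a Hilbert space yields Hilbert kernels on finite subsets with
logarithmic lower bounds and small power upper bounds. -/
theorem exists_isHilbertKernelOn_finset {X H : Type*} [NormedAddCommGroup H]
    [InnerProductSpace ℝ H] (m : PseudoMetricSpace X) (f : X → H) {p B : ℝ} (hp0 : 0 < p)
    (hp2 : p ≤ 2) (hB : 0 ≤ B) (hf : ∀ x y, ‖f x - f y‖ ^ p ≤ B * (m.dist x y + 1))
    {C : ℝ} (hC : C = 2 * (1 - (2 : ℝ) ^ (-p))⁻¹ * B) {L U : X → X → ℝ}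
    (hL : ∀ x y, L x y ≤ (Nat.log 2 ⌊‖f x - f y‖⌋₊ : ℝ) / 2 - 2 * C)
    (hU : ∀ x y, C * m.dist x y ≤ U x y) (F : Finset X) :
    ∃ k, IsHilbertKernelOn L U (F : Set X) k := by
  classical
  have hD : 0 ≤ 2 * (1 - (2 : ℝ) ^ (-p))⁻¹ := by
    have : (2 : ℝ) ^ (-p) < 1 := Real.rpow_lt_one_of_one_lt_of_neg (by norm_num) (by linarith)
    have : 0 < 1 - (2 : ℝ) ^ (-p) := by linarith
    positivity
  have hC0 : 0 ≤ C := hC ▸ mul_nonneg hD hB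
  obtain ⟨d, b, hb⟩ := exists_snowflake (fun x : F => f x) hp0 hp2
  obtain ⟨h, hh, hhb⟩ := exists_close_holder b hC0 fun x y => (hb x y).2.trans (by
    rw [hC, mul_assoc _ B]
    exact mul_le_mul_of_nonneg_left (hf x y) hD)
  let h' : X → EuclideanSpace ℝ (Fin d) := fun x => if hx : x ∈ F then h ⟨x, hx⟩ else 0
  have hh' : ∀ x (hx : x ∈ F), h' x = h ⟨x, hx⟩ := fun x hx => dif_pos hx
  refine ⟨_, isHilbertKernelOn_norm_sub_sq h' (fun x hx y hy => ?_) fun x hx y hy => ?_⟩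
  · rw [hh' x hx, hh' y hy]
    refine (hL x y).trans ?_
    set x' : F := ⟨x, hx⟩
    set y' : F := ⟨y, hy⟩
    have h1 := (hb x' y').1
    have h2 := hhb x'
    have h3 := hhb y'
    have h4 : ‖b x' - b y'‖ ≤ ‖h x' - b x'‖ + ‖h x' - h y'‖ + ‖h y' - b y'‖ := by
      calc ‖b x' - b y'‖ = ‖-(h x' - b x') + (h x' - h y') + (h y' - b y')‖ := by congr 1; abel
        _ ≤ _ := (norm_add₃_le).trans_eq (by rw [norm_neg])
    have h5 : ‖b x' - b y'‖ ^ 2 ≤ (‖h x' - b x'‖ + ‖h x' - h y'‖ + ‖h y' - b y'‖) ^ 2 := by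
      gcongr
    have h6 := sq_nonneg (‖h x' - b x'‖ - ‖h y' - b y'‖)
    have h7 := sq_nonneg (‖h x' - h y'‖ - (‖h x' - b x'‖ + ‖h y' - b y'‖))
    change (Nat.log 2 ⌊‖f x - f y‖⌋₊ : ℝ) ≤ _ at h1
    linarith
  · rw [hh' x hx, hh' y hy]
    exact (hh _ _).trans (hU x y)

theorem tendsto_natLog_floor : Tendsto (fun r : ℝ => (Nat.log 2 ⌊r⌋₊ : ℝ)) atTop atTop := by
  have hlog : Tendsto (Nat.log 2) atTop atTop :=
    tendsto_atTop.2 fun b => (eventually_ge_atTop (2 ^ b)).mono fun n hn =>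
      Nat.le_log_of_pow_le one_lt_two hn
  exact tendsto_natCast_atTop_atTop.comp (hlog.comp tendsto_nat_floor_atTop)

theorem monotone_natLog_floor : Monotone fun r : ℝ => (Nat.log 2 ⌊r⌋₊ : ℝ) :=
  Nat.mono_cast.comp ((Nat.log_monotone).comp Nat.floor_mono)

/-- If a quasi-Banach space `X` coarsely embeds into a real, infinite-dimensional Hilbert
space, then there is a continuous negative definite function `g` on `X` with `g 0 = 0` and
`φ₁(‖x‖) ≤ g x ≤ ‖x‖ ^ (2α)` for some nondecreasing `φ₁` tending to `∞` and some `α > 0`. -/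
theorem exists_negativeDefinite_of_coarseEmbeds_hilbert
    (X : Type*) [AddCommGroup X] [Module ℝ X] (q : X → ℝ)
    (hq : IsQuasiNorm q) (hcomplete : QuasiNormComplete q)
    (hembed : CoarselyEmbedsIntoHilbert X q) :
    ∃ (g : X → ℝ) (φ₁ : ℝ → ℝ) (α : ℝ),
      0 < α ∧
      Monotone φ₁ ∧
      Tendsto φ₁ atTop atTop ∧
      -- `g` is (sequentially) continuous for the quasi-norm topology on `X`
      (∀ (x : X) (u : ℕ → X), Tendsto (fun n => q (u n - x)) atTop (nhds 0) →
        Tendsto (fun n => g (u n)) atTop (nhds (g x))) ∧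
      IsNegativeDefinite g ∧
      g 0 = 0 ∧
      ∀ x : X, φ₁ (q x) ≤ g x ∧ g x ≤ (q x) ^ (2 * α) := by
  obtain ⟨p, hp0, hp1, m, hm⟩ := hq.exists_pseudoMetricSpace
  obtain ⟨K, hK1, hK⟩ := hq.exists_K
  obtain ⟨H, f, φ₁, φ₂, hφ₁, hφ₂, hφ₁lim, hf⟩ := hembed
  let C₀ : ℝ := max (φ₂ 1) 1
  have hC₀ : 0 < C₀ := one_pos.trans_le (le_max_right _ _)
  have hLip := hq.dist_le_of_dist_le f hC₀.le fun x y hxy =>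
    ((hf x y).2.trans (hφ₂ hxy)).trans (le_max_left _ _)
  have hpow : ∀ x y, ‖f x - f y‖ ^ p ≤ 2 * C₀ ^ p * (m.dist x y + 1) := by
    intro x y
    have hxy := hq.nonneg (x - y)
    have h1 : (q (x - y) + 1) ^ p ≤ q (x - y) ^ p + 1 := by
      simpa using Real.rpow_add_le_add_rpow hxy zero_le_one hp0.le hp1
    calc ‖f x - f y‖ ^ p ≤ (C₀ * (q (x - y) + 1)) ^ p := by
          rw [← dist_eq_norm]
          exact Real.rpow_le_rpow dist_nonneg (hLip x y) hp0.le
      _ = C₀ ^ p * (q (x - y) + 1) ^ p := Real.mul_rpow hC₀.le (by linarith)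
      _ ≤ C₀ ^ p * (2 * (m.dist x y + 1)) := by
          have := (hm x y).2
          gcongr
          linarith
      _ = _ := by ring
  set C : ℝ := 2 * (1 - (2 : ℝ) ^ (-p))⁻¹ * (2 * C₀ ^ p) with hC
  have hC0 : 0 < C := by
    have : (2 : ℝ) ^ (-p) < 1 := Real.rpow_lt_one_of_one_lt_of_neg (by norm_num) (by linarith)
    have : 0 < 1 - (2 : ℝ) ^ (-p) := by linarith
    positivity
  let ℓ : ℝ → ℝ := fun t => (Nat.log 2 ⌊φ₁ t⌋₊ : ℝ) / 2 - 2 * C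
  have hℓ : Monotone ℓ := fun s t hst => by
    have := monotone_natLog_floor (hφ₁ hst)
    simp only [ℓ] at this ⊢
    linarith
  have hℓlim : Tendsto ℓ atTop atTop := tendsto_atTop_add_const_right _ _
    ((tendsto_natLog_floor.comp hφ₁lim).atTop_div_const two_pos)
  obtain ⟨k, hk, hinv⟩ := exists_invariant_isHilbertKernelOn
    (L := fun x y => ℓ (q (x - y))) (U := fun x y => C * q (x - y) ^ p)
    (fun z x y => by simp only [add_sub_add_right_eq_sub])
    (fun z x y => by simp only [add_sub_add_right_eq_sub])
    (exists_isHilbertKernelOn_univ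
      (exists_isHilbertKernelOn_finset m f hp0 (by linarith) (by positivity) hpow hC
        (fun x y => by
          have := monotone_natLog_floor (hf x y).1
          rw [dist_eq_norm] at this
          simp only [ℓ] at this ⊢
          linarith)
        fun x y => mul_le_mul_of_nonneg_left (hm x y).1 hC0.le))
  refine ⟨fun x => C⁻¹ * k x 0, fun t => C⁻¹ * ℓ t, p / 2, by linarith,
    hℓ.const_mul (by positivity), hℓlim.const_mul_atTop (by positivity), ?_,
    hk.isNegativeDefinite hinv (by positivity), by simp [hk.diag 0 trivial], fun x => ⟨?_, ?_⟩⟩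
  · intro x u hu
    refine Tendsto.const_mul _ (tendsto_iff_dist_tendsto_zero.2 ?_)
    let β : ℝ → ℝ := fun t => √(C * t ^ p) * (√(C * (K * (t + q x)) ^ p) + √(C * q x ^ p))
    have hβ : Continuous β := by
      have := Real.continuous_rpow_const hp0.le
      fun_prop
    have hβ0 : β 0 = 0 := by simp [β, Real.zero_rpow hp0.ne']
    have hlim : Tendsto (fun n => β (q (u n - x))) atTop (nhds 0) := by
      have := (hβ.tendsto 0).comp hu
      rwa [hβ0] at this
    refine squeeze_zero (fun _ => dist_nonneg) (fun n => ?_) hlim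
    have hneg : q (x - u n) = q (u n - x) := by
      rw [← neg_sub]
      simpa using hq.smul (-1) (u n - x)
    have h1 := hk.sub_le (u n) trivial x trivial 0 trivial
    have h2 := hk.sub_le x trivial (u n) trivial 0 trivial
    simp only [sub_zero, hneg] at h1 h2
    have h3 : q (u n) ≤ K * (q (u n - x) + q x) := by simpa using hK (u n - x) x
    have h4 : √(C * q (u n) ^ p) ≤ √(C * (K * (q (u n - x) + q x)) ^ p) := by
      have := hq.nonneg (u n)
      gcongr
    have h5 : √(C * q (u n - x) ^ p) * (√(C * q (u n) ^ p) + √(C * q x ^ p)) ≤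
        β (q (u n - x)) := by
      simp only [β]
      gcongr
    rw [add_comm √(C * q x ^ p)] at h2
    rw [Real.dist_eq, abs_le]
    constructor <;> linarith
  · have := hk.lower x trivial 0 trivial
    rw [sub_zero] at this
    exact mul_le_mul_of_nonneg_left this (by positivity)
  · have := hk.upper x trivial 0 trivial
    rw [sub_zero] at this
    rw [mul_div_cancel₀ p two_ne_zero, inv_mul_le_iff₀ hC0]
    exact this
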